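/- arXiv:1603.02961 — 4 statements merged into one kernel-verified Lean document; each statement's English description precedes it below -/
import Mathlib

section
/- There exist a₀ > 0 and, for every real a with |a| < a₀, a real number γ(a) and a smooth, even, 2π-periodic function U_a : ℝ → ℝ satisfying ((γ(a) − (1/2)·U_a(z)²)·U_a'(z))' + U_a(z) = 0 for all z ∈ ℝ, such that: (i) for every integer n ≥ 0 there is a constant C_n > 0 with sup_{z∈ℝ} |(d/dz)ⁿ( U_a(z) − a·cos z − (3a³/64)·cos 3z )| ≤ C_n·|a|⁵ for all |a| < a₀; (ii) there is C > 0 with |γ(a) − 1 − a²/8| ≤ C·a⁴ for all |a| < a₀; (iii) the function z ↦ (1/2)(γ(a) − (1/2)U_a(z)²)²·U_a'(z)² + (γ(a)/2)·U_a(z)² − (1/8)·U_a(z)⁴ is constant in z, and its constant value I(a) satisfies |I(a) − a²/2| ≤ C·a⁴ for all |a| < a₀. -/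
open Real

open Filter Topology
open scoped ENNReal NNReal

noncomputable section

namespace StokesExpansion

section Lift

variable {F : Type*} [NormedAddCommGroup F] [NormedSpace ℝ F]

/-- The space `ℓ¹(ℕ)`. Its `k`-th unit vector stands for the function `z ↦ e⁻ᵏ cos (k z)`. -/
abbrev Coeff : Type := lp (fun _ : ℕ => ℝ) 1

/-- The `k`-th unit vector of `ℓ¹(ℕ)`. -/
def unit (k : ℕ) : Coeff := lp.single 1 k (1 : ℝ)

lemma norm_unit (k : ℕ) : ‖unit k‖ = 1 := by
  simp [unit, lp.norm_single]

lemma hasSum_norm_coeff (x : Coeff) : HasSum (fun k => ‖x k‖) ‖x‖ := by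
  simpa using lp.hasSum_norm (p := 1) (by simp) x

lemma summable_smul {f : ℕ → F} {C : ℝ} (hf : ∀ k, ‖f k‖ ≤ C) (x : Coeff) :
    Summable fun k => ‖x k • f k‖ := by
  refine .of_nonneg_of_le (fun _ => norm_nonneg _) (fun k => ?_)
    ((hasSum_norm_coeff x).summable.mul_right C)
  rw [norm_smul]
  gcongr
  exact hf k

/-- The continuous linear map on `ℓ¹(ℕ)` with prescribed bounded values on the unit vectors. -/
def lift [CompleteSpace F] (f : ℕ → F) (C : ℝ) (hf : ∀ k, ‖f k‖ ≤ C) : Coeff →L[ℝ] F :=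
  LinearMap.mkContinuous
    { toFun := fun x => ∑' k, x k • f k
      map_add' := fun x y => by
        simp only [lp.coeFn_add, Pi.add_apply, add_smul]
        exact (summable_smul hf x).of_norm.tsum_add (summable_smul hf y).of_norm
      map_smul' := fun c x => by
        simp only [lp.coeFn_smul, Pi.smul_apply, smul_assoc, RingHom.id_apply]
        exact (summable_smul hf x).of_norm.tsum_const_smul c }
    C fun x => by
      have h := (hasSum_norm_coeff x).mul_left C
      refine tsum_of_norm_bounded h fun k => ?_
      rw [norm_smul, mul_comm]
      gcongr
      exact hf k

lemma lift_apply [CompleteSpace F] (f : ℕ → F) (C : ℝ) (hf : ∀ k, ‖f k‖ ≤ C) (x : Coeff) :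
    lift f C hf x = ∑' k, x k • f k := rfl

lemma lift_unit [CompleteSpace F] (f : ℕ → F) (C : ℝ) (hf : ∀ k, ‖f k‖ ≤ C) (k : ℕ) :
    lift f C hf (unit k) = f k := by
  rw [lift_apply, tsum_eq_single k]
  · simp [unit]
  · intro j hj
    simp [unit, Pi.single_eq_of_ne hj]

lemma norm_lift_le [CompleteSpace F] (f : ℕ → F) (C : ℝ) (hf : ∀ k, ‖f k‖ ≤ C) : ‖lift f C hf‖ ≤ C :=
  LinearMap.mkContinuous_norm_le _ ((norm_nonneg _).trans (hf 0)) _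

lemma clm_ext {A B : Coeff →L[ℝ] F} (h : ∀ k, A (unit k) = B (unit k)) : A = B := by
  refine lp.ext_continuousLinearMap (by simp) fun k => ?_
  ext
  simpa [unit] using h k

end Lift

section Evaluation

lemma norm_deriv_term_le (n : ℕ) (z : ℝ) (k : ℕ) :
    ‖exp (-k) * (k : ℝ) ^ n * cos (k * z + n * (π / 2))‖ ≤ n.factorial := by
  have h1 : (k : ℝ) ^ n ≤ n.factorial * exp k := by
    have := pow_div_factorial_le_exp (k : ℝ) (Nat.cast_nonneg k) n
    rwa [div_le_iff₀' (by positivity)] at this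
  rw [norm_mul, Real.norm_eq_abs, Real.norm_eq_abs, abs_of_nonneg (by positivity)]
  calc exp (-k) * (k : ℝ) ^ n * |cos (k * z + n * (π / 2))|
      ≤ exp (-k) * (n.factorial * exp k) * 1 := by
        gcongr
        exact abs_cos_le_one _
    _ = n.factorial := by
        rw [mul_one, mul_left_comm, ← exp_add]
        simp

/-- The value at `z` of the `n`-th derivative of the cosine series with coefficients `x`. -/
def evalDeriv (n : ℕ) (z : ℝ) : Coeff →L[ℝ] ℝ :=
  lift (fun k => exp (-k) * (k : ℝ) ^ n * cos (k * z + n * (π / 2))) n.factorial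
    (norm_deriv_term_le n z)

lemma evalDeriv_unit (n : ℕ) (z : ℝ) (k : ℕ) :
    evalDeriv n z (unit k) = exp (-k) * (k : ℝ) ^ n * cos (k * z + n * (π / 2)) :=
  lift_unit _ _ _ k

lemma abs_evalDeriv_le (n : ℕ) (z : ℝ) (x : Coeff) :
    |evalDeriv n z x| ≤ n.factorial * ‖x‖ :=
  (evalDeriv n z).le_of_opNorm_le (norm_lift_le _ _ _) x

lemma hasDerivAt_evalDeriv (n : ℕ) (x : Coeff) (z : ℝ) :
    HasDerivAt (fun w => evalDeriv n w x) (evalDeriv (n + 1) z x) z := by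
  refine hasDerivAt_tsum
    (g := fun (k : ℕ) (w : ℝ) => x k • (exp (-k) * (k : ℝ) ^ n * cos (k * w + n * (π / 2))))
    (g' := fun (k : ℕ) (w : ℝ) =>
      x k • (exp (-k) * (k : ℝ) ^ (n + 1) * cos (k * w + (n + 1 : ℕ) * (π / 2))))
    (u := fun k => ‖x k‖ * (n + 1).factorial) (y₀ := 0)
    ((hasSum_norm_coeff x).summable.mul_right _) (fun k w => ?_) (fun k w => ?_)
    (summable_smul (norm_deriv_term_le n 0) x).of_norm z
  · have h : HasDerivAt (fun w : ℝ => (k : ℝ) * w + n * (π / 2)) k w := by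
      simpa using ((hasDerivAt_id w).const_mul (k : ℝ)).add_const (n * (π / 2))
    have h2 := (h.cos.const_mul (exp (-k) * (k : ℝ) ^ n)).const_mul (x k)
    refine h2.congr_deriv ?_
    have : (k : ℝ) * w + (n + 1 : ℕ) * (π / 2) = (k * w + n * (π / 2)) + π / 2 := by
      push_cast; ring
    rw [this, cos_add_pi_div_two, smul_eq_mul]
    ring
  · rw [norm_smul]
    gcongr
    exact norm_deriv_term_le (n + 1) w k

lemma iteratedDeriv_evalDeriv (n : ℕ) (x : Coeff) :
    iteratedDeriv n (fun w => evalDeriv 0 w x) = fun w => evalDeriv n w x := by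
  induction n with
  | zero => exact iteratedDeriv_zero
  | succ n ih =>
    rw [iteratedDeriv_succ, ih]
    exact funext fun z => (hasDerivAt_evalDeriv n x z).deriv

lemma contDiff_evalDeriv (x : Coeff) : ContDiff ℝ (⊤ : ℕ∞) fun w => evalDeriv 0 w x := by
  refine contDiff_of_differentiable_iteratedDeriv fun n _ => ?_
  rw [iteratedDeriv_evalDeriv]
  exact fun z => (hasDerivAt_evalDeriv n x z).differentiableAt

lemma evalDeriv_neg (z : ℝ) : evalDeriv 0 (-z) = evalDeriv 0 z :=
  clm_ext fun k => by simp [evalDeriv_unit]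

lemma evalDeriv_add_two_pi (z : ℝ) : evalDeriv 0 (z + 2 * π) = evalDeriv 0 z :=
  clm_ext fun k => by
    simp only [evalDeriv_unit, CharP.cast_eq_zero, zero_mul, add_zero, mul_add]
    rw [cos_add_nat_mul_two_pi]

end Evaluation

section Product

/-- The product of two unit vectors. -/
def unitMul (i j : ℕ) : Coeff :=
  (1 / 2 : ℝ) • (unit (i + j) + exp (-(2 * min i j : ℕ)) • unit (max i j - min i j))

lemma norm_unitMul_le (i j : ℕ) : ‖unitMul i j‖ ≤ 1 := by
  have h : ‖exp (-(2 * min i j : ℕ)) • unit (max i j - min i j)‖ ≤ 1 := by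
    rw [norm_smul, norm_unit, mul_one, Real.norm_eq_abs, abs_exp, exp_le_one_iff]
    exact neg_nonpos.2 (Nat.cast_nonneg _)
  rw [unitMul, norm_smul, Real.norm_of_nonneg (by norm_num)]
  have h2 := norm_add_le (unit (i + j)) (exp (-(2 * min i j : ℕ)) • unit (max i j - min i j))
  rw [norm_unit] at h2
  linarith

lemma unitMul_comm (i j : ℕ) : unitMul i j = unitMul j i := by
  rw [unitMul, unitMul, add_comm i j, min_comm, max_comm]

/-- Multiplication of cosine series. -/
def mul : Coeff →L[ℝ] Coeff →L[ℝ] Coeff :=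
  lift (fun i => lift (unitMul i) 1 (norm_unitMul_le i)) 1 fun i =>
    norm_lift_le (unitMul i) 1 (norm_unitMul_le i)

lemma mul_unit (i j : ℕ) : mul (unit i) (unit j) = unitMul i j := by
  rw [mul, lift_unit, lift_unit]

lemma evalDeriv_unitMul (z : ℝ) (i j : ℕ) :
    evalDeriv 0 z (unitMul i j) = evalDeriv 0 z (unit i) * evalDeriv 0 z (unit j) := by
  wlog h : i ≤ j generalizing i j
  · rw [unitMul_comm, this j i (le_of_not_ge h), mul_comm]
  obtain ⟨d, rfl⟩ := Nat.exists_eq_add_of_le h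
  rw [unitMul, min_eq_left h, max_eq_right h, Nat.add_sub_cancel_left]
  simp only [map_smul, map_add, evalDeriv_unit, smul_eq_mul]
  have e1 : exp (-((2 * i : ℕ) : ℝ)) = exp (-(i : ℝ)) * exp (-(i : ℝ)) := by
    rw [← exp_add]; push_cast; ring_nf
  have e2 : exp (-((i + d : ℕ) : ℝ)) = exp (-(i : ℝ)) * exp (-(d : ℝ)) := by
    rw [← exp_add]; push_cast; ring_nf
  have e3 : exp (-((i + (i + d) : ℕ) : ℝ)) = exp (-(i : ℝ)) * exp (-(i : ℝ)) * exp (-(d : ℝ)) := by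
    rw [← exp_add, ← exp_add]; push_cast; ring_nf
  have c1 : cos (d * z) =
      cos ((i + d : ℕ) * z) * cos (i * z) + sin ((i + d : ℕ) * z) * sin (i * z) := by
    rw [← cos_sub]; push_cast; ring_nf
  have c2 : cos ((i + (i + d) : ℕ) * z) =
      cos ((i + d : ℕ) * z) * cos (i * z) - sin ((i + d : ℕ) * z) * sin (i * z) := by
    rw [← cos_add]; push_cast; ring_nf
  simp only [CharP.cast_eq_zero, zero_mul, add_zero, pow_zero, mul_one, e1, e2, e3, c1, c2]
  ring

lemma evalDeriv_mul (z : ℝ) (x y : Coeff) :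
    evalDeriv 0 z (mul x y) = evalDeriv 0 z x * evalDeriv 0 z y := by
  have h : (ContinuousLinearMap.compL ℝ Coeff Coeff ℝ (evalDeriv 0 z)).comp mul =
      (ContinuousLinearMap.mul ℝ ℝ).bilinearComp (evalDeriv 0 z) (evalDeriv 0 z) := by
    refine clm_ext fun i => clm_ext fun j => ?_
    simpa [mul_unit] using evalDeriv_unitMul z i j
  simpa using congr($h x y)

/-- The cube of a cosine series. -/
def cube (x : Coeff) : Coeff := mul (mul x x) x

lemma evalDeriv_cube (z : ℝ) (x : Coeff) : evalDeriv 0 z (cube x) = evalDeriv 0 z x ^ 3 := by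
  rw [cube, evalDeriv_mul, evalDeriv_mul]
  ring

lemma contDiff_cube : ContDiff ℝ 1 cube := by
  unfold cube
  fun_prop

end Product

section Reduction

/-- The coefficient sequence of `cos`. -/
def cosCoeff : Coeff := exp 1 • unit 1

lemma evalDeriv_cosCoeff (z : ℝ) : evalDeriv 0 z cosCoeff = cos z := by
  simp [cosCoeff, evalDeriv_unit, ← mul_assoc, ← exp_add]

lemma evalDeriv_two_cosCoeff (z : ℝ) : evalDeriv 2 z cosCoeff = -cos z := by
  simp [cosCoeff, evalDeriv_unit, ← mul_assoc, ← exp_add, mul_div_cancel₀, cos_add_pi]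

lemma cube_cosCoeff :
    cube cosCoeff = (3 / 4 * exp 1) • unit 1 + (1 / 4 * exp 1 ^ 3) • unit 3 := by
  have e2 : exp (-2) = (exp 1 ^ 2)⁻¹ := by
    rw [← exp_nat_mul, ← exp_neg]; norm_num
  have h1 : mul (unit 1) (unit 1) = (1 / 2 : ℝ) • (unit 2 + (exp 1 ^ 2)⁻¹ • unit 0) := by
    rw [mul_unit, unitMul]; simp [e2]
  have h2 : mul (unit 2) (unit 1) = (1 / 2 : ℝ) • (unit 3 + (exp 1 ^ 2)⁻¹ • unit 1) := by
    rw [mul_unit, unitMul]; simp [e2]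
  have h3 : mul (unit 0) (unit 1) = unit 1 := by
    rw [mul_unit, unitMul]; simp [← two_smul ℝ, smul_smul]
  simp only [cube, cosCoeff, map_smul, smul_apply, h1, map_add,
    add_apply, h2, h3]
  have : exp 1 ≠ 0 := (exp_pos 1).ne'
  match_scalars <;> field_simp <;> norm_num

/-- The symbol of `∂² (∂² + 1)⁻¹` away from the kernel of `∂² + 1`. -/
def symbol (k : ℕ) : ℝ := if k = 1 then 0 else (k : ℝ) ^ 2 / ((k : ℝ) ^ 2 - 1)

lemma norm_symbol_smul_unit_le (k : ℕ) : ‖symbol k • unit k‖ ≤ 2 := by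
  rw [norm_smul, norm_unit, mul_one, symbol]
  split_ifs with h
  · simp
  · rcases Nat.lt_or_gt_of_ne h with h | h
    · obtain rfl : k = 0 := by omega
      simp
    · have : (2 : ℝ) ≤ k := by exact_mod_cast h
      rw [Real.norm_eq_abs, abs_of_nonneg (div_nonneg (by positivity) (by nlinarith)),
        div_le_iff₀ (by nlinarith)]
      nlinarith

/-- The partial inverse `∂² (∂² + 1)⁻¹`, vanishing on `cos`. -/
def partialInv : Coeff →L[ℝ] Coeff := lift (fun k => symbol k • unit k) 2 norm_symbol_smul_unit_le

lemma partialInv_unit (k : ℕ) : partialInv (unit k) = symbol k • unit k := lift_unit _ _ _ k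

/-- The first coordinate. -/
def firstCoord : Coeff →L[ℝ] ℝ := lp.evalCLM ℝ (fun _ : ℕ => ℝ) 1 1

lemma firstCoord_unit (k : ℕ) : firstCoord (unit k) = if k = 1 then 1 else 0 := by
  change (unit k) 1 = _
  simp [unit, Pi.single_apply, eq_comm]

lemma firstCoord_partialInv (x : Coeff) : firstCoord (partialInv x) = 0 := by
  have : firstCoord.comp partialInv = 0 := clm_ext fun k => by
    by_cases h : k = 1 <;> simp [partialInv_unit, firstCoord_unit, symbol, h]
  exact congr($this x)

lemma evalDeriv_partialInv (z : ℝ) (x : Coeff) :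
    evalDeriv 2 z (partialInv x) + evalDeriv 0 z (partialInv x) =
      evalDeriv 2 z x + firstCoord x * (exp (-1) * cos z) := by
  have : (evalDeriv 2 z).comp partialInv + (evalDeriv 0 z).comp partialInv =
      evalDeriv 2 z + (exp (-1) * cos z) • firstCoord := clm_ext fun k => by
    have h2 : (2 : ℝ) * (π / 2) = π := by ring
    by_cases h : k = 1
    · subst h
      simp [partialInv_unit, firstCoord_unit, symbol, evalDeriv_unit, h2, cos_add_pi]
    · have hk : (k : ℝ) ^ 2 - 1 ≠ 0 := by
        intro h0
        have : (k : ℝ) ^ 2 = 1 := by linarith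
        rw [pow_eq_one_iff_of_nonneg (Nat.cast_nonneg k) two_ne_zero] at this
        exact h (by exact_mod_cast this)
      simp [partialInv_unit, firstCoord_unit, symbol, evalDeriv_unit, h2, cos_add_pi, h]
      field_simp
      ring
  have := congr($this x)
  simp only [add_apply, ContinuousLinearMap.comp_apply,
    smul_apply, smul_eq_mul] at this
  rw [this]
  ring

/-- The correction to the wave speed, divided by the squared amplitude. -/
def speed (W : Coeff) : ℝ := firstCoord (cube (cosCoeff + W)) / (6 * exp 1)

/-- The profile `a (cos + W)` solves the wave equation when `W = a² profileMap W`. -/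
def profileMap (W : Coeff) : Coeff :=
  partialInv ((1 / 6 : ℝ) • cube (cosCoeff + W) - speed W • W)

lemma contDiff_speed : ContDiff ℝ 1 speed := by
  unfold speed
  exact (firstCoord.contDiff.comp (contDiff_cube.comp (contDiff_const.add contDiff_id))).div_const _

lemma contDiff_profileMap : ContDiff ℝ 1 profileMap := by
  unfold profileMap
  have h := contDiff_cube.comp (contDiff_const (c := cosCoeff).add contDiff_id)
  exact partialInv.contDiff.comp ((h.const_smul _).sub (contDiff_speed.smul contDiff_id))

lemma speed_zero : speed 0 = 1 / 8 := by
  have : exp 1 ≠ 0 := (exp_pos 1).ne'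
  simp [speed, cube_cosCoeff, firstCoord_unit]
  field_simp
  norm_num

lemma profileMap_zero : profileMap 0 = (3 / 64 * exp 1 ^ 3) • unit 3 := by
  simp [profileMap, cube_cosCoeff, partialInv_unit, symbol, smul_smul]
  congr 1
  ring

lemma evalDeriv_profileMap_zero (z : ℝ) : evalDeriv 0 z (profileMap 0) = 3 / 64 * cos (3 * z) := by
  have e : exp 1 ^ 3 * exp (-3) = 1 := by
    rw [← exp_nat_mul, ← exp_add]; norm_num
  simp only [profileMap_zero, map_smul, evalDeriv_unit, smul_eq_mul]
  push_cast
  rw [zero_mul, add_zero]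
  linear_combination (3 / 64 * cos (3 * z)) * e

lemma evalDeriv_two_of_fixedPoint {ε : ℝ} {W : Coeff} (hW : W = ε • profileMap W) (z : ℝ) :
    evalDeriv 2 z ((1 + ε * speed W) • (cosCoeff + W) - (ε / 6) • cube (cosCoeff + W)) =
      -evalDeriv 0 z (cosCoeff + W) := by
  have h1 : firstCoord W = 0 := by
    rw [hW, map_smul, profileMap, firstCoord_partialInv, smul_zero]
  have h2 := evalDeriv_partialInv z ((1 / 6 : ℝ) • cube (cosCoeff + W) - speed W • W)
  have h3 : ∀ n, evalDeriv n z W = ε * evalDeriv n z (profileMap W) := fun n => by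
    conv_lhs => rw [hW]
    simp
  have h4 : firstCoord (cube (cosCoeff + W)) * exp (-1) = 6 * speed W := by
    rw [speed, exp_neg]
    field_simp
  have h5 := h3 2
  have h6 := h3 0
  rw [profileMap] at h5 h6
  simp only [map_sub, map_smul, map_add, smul_eq_mul, h1, evalDeriv_cosCoeff,
    evalDeriv_two_cosCoeff] at h2 h5 h6 ⊢
  linear_combination ε * h2 + h5 + h6 + ε * cos z / 6 * h4

end Reduction

section FixedPoint

variable {E : Type*} [NormedAddCommGroup E] [NormedSpace ℝ E] [CompleteSpace E]

/-- A `C¹` perturbation problem `W = ε F(W)` has a small solution, equal to `ε F(0)` up to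
second order; the value of a `C¹` function `G` at `W` moves by `O(ε)`. -/
lemma exists_small_fixedPoint {F : E → E} {G : E → ℝ} (hF : ContDiffAt ℝ 1 F 0)
    (hG : ContDiffAt ℝ 1 G 0) :
    ∃ ε₀ > (0 : ℝ), ∃ C > (0 : ℝ), ∀ ε : ℝ, |ε| < ε₀ → ∃ W : E, W = ε • F W ∧
      ‖W‖ ≤ C * |ε| ∧ ‖W - ε • F 0‖ ≤ C * ε ^ 2 ∧ |G W - G 0| ≤ C * |ε| := by
  obtain ⟨K, s, hs, hK⟩ := hF.exists_lipschitzOnWith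
  obtain ⟨L, t, ht, hL⟩ := hG.exists_lipschitzOnWith
  obtain ⟨r, hr, hrst⟩ := Metric.nhds_basis_closedBall.mem_iff.1 (inter_mem hs ht)
  have h0 : (0 : E) ∈ Metric.closedBall (0 : E) r := by simpa using hr.le
  have hFW : ∀ W ∈ Metric.closedBall (0 : E) r, ‖F W - F 0‖ ≤ K * ‖W‖ := fun W hW => by
    simpa using hK.norm_sub_le (hrst hW).1 (hrst h0).1
  have hGW : ∀ W ∈ Metric.closedBall (0 : E) r, |G W - G 0| ≤ L * ‖W‖ := fun W hW => by
    simpa using hL.norm_sub_le (hrst hW).2 (hrst h0).2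
  set M : ℝ := ‖F 0‖ + K * r with hM
  have hM0 : 0 ≤ M := by positivity
  have hbound : ∀ W ∈ Metric.closedBall (0 : E) r, ‖F W‖ ≤ M := fun W hW => by
    have h1 : ‖W‖ ≤ r := by simpa using hW
    have h2 : (K : ℝ) * ‖W‖ ≤ K * r := by gcongr
    have h3 := norm_le_norm_add_norm_sub' (F W) (F 0)
    linarith [hFW W hW]
  refine ⟨min (1 / (2 * (K + 1))) (r / (M + 1)), by positivity, M + K * M + L * M + 1,
    by positivity, fun ε hε => ?_⟩
  have hεK : |ε| * K ≤ 1 / 2 := by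
    have h := (lt_div_iff₀ (by positivity)).1 (hε.trans_le (min_le_left _ _))
    nlinarith [abs_nonneg ε]
  have hεM : |ε| * M ≤ r := by
    have h := (lt_div_iff₀ (by positivity)).1 (hε.trans_le (min_le_right _ _))
    nlinarith [abs_nonneg ε]
  have hmaps : Set.MapsTo (fun W => ε • F W) (Metric.closedBall (0 : E) r)
      (Metric.closedBall (0 : E) r) := fun W hW => by
    rw [mem_closedBall_zero_iff, norm_smul, Real.norm_eq_abs]
    exact (mul_le_mul_of_nonneg_left (hbound W hW) (abs_nonneg ε)).trans hεM
  have hcontr : ContractingWith (1 / 2) (hmaps.restrict (fun W => ε • F W) _ _) := by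
    refine ⟨by norm_num, LipschitzWith.of_dist_le_mul fun x y => ?_⟩
    change dist (ε • F x) (ε • F y) ≤ _ * dist (x : E) y
    rw [dist_smul₀, Real.norm_eq_abs]
    have h := hK.dist_le_mul _ (hrst x.2).1 _ (hrst y.2).1
    calc |ε| * dist (F x) (F y) ≤ |ε| * (K * dist (x : E) y) := by gcongr
      _ = |ε| * K * dist (x : E) y := by ring
      _ ≤ _ := by
        gcongr
        simpa using hεK
  obtain ⟨W, hW, hfix, -⟩ := hcontr.exists_fixedPoint' Metric.isClosed_closedBall.isComplete
    hmaps h0 (edist_ne_top _ _)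
  have hfix : W = ε • F W := hfix.symm
  have hWn : ‖W‖ ≤ M * |ε| := by
    calc ‖W‖ = |ε| * ‖F W‖ := by
          conv_lhs => rw [hfix]
          rw [norm_smul, Real.norm_eq_abs]
      _ ≤ |ε| * M := by
          gcongr
          exact hbound W hW
      _ = M * |ε| := mul_comm _ _
  have hKM : (0 : ℝ) ≤ K * M := by positivity
  have hLM : (0 : ℝ) ≤ L * M := by positivity
  refine ⟨W, hfix, ?_, ?_, ?_⟩
  · nlinarith [abs_nonneg ε]
  · have h : ‖W - ε • F 0‖ ≤ K * M * ε ^ 2 := by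
      calc ‖W - ε • F 0‖ = |ε| * ‖F W - F 0‖ := by
            conv_lhs => rw [hfix]
            rw [← smul_sub, norm_smul, Real.norm_eq_abs]
        _ ≤ |ε| * (K * (M * |ε|)) := by
            gcongr
            exact (hFW W hW).trans (by gcongr)
        _ = K * M * ε ^ 2 := by rw [← sq_abs ε]; ring
    nlinarith [sq_nonneg ε]
  · have h : |G W - G 0| ≤ L * (M * |ε|) := (hGW W hW).trans (by gcongr)
    nlinarith [abs_nonneg ε]

end FixedPoint

section Wave

lemma hasDerivAt_flux {a : ℝ} {W : Coeff} (hW : W = a ^ 2 • profileMap W) (z : ℝ) :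
    HasDerivAt (fun w => (1 + a ^ 2 * speed W
        - (1 / 2) * evalDeriv 0 w (a • (cosCoeff + W)) ^ 2) *
          deriv (fun v => evalDeriv 0 v (a • (cosCoeff + W))) w)
      (-evalDeriv 0 z (a • (cosCoeff + W))) z := by
  set V := cosCoeff + W with hV
  set g := 1 + a ^ 2 * speed W with hg
  set q := a • (g • V - (a ^ 2 / 6) • cube V) with hq
  have hflux : (fun w => (g - (1 / 2) * evalDeriv 0 w (a • V) ^ 2) *
      deriv (fun v => evalDeriv 0 v (a • V)) w) = fun w => evalDeriv 1 w q := by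
    funext w
    have h1 := hasDerivAt_evalDeriv 0 (a • V) w
    have h2 : HasDerivAt (fun v => evalDeriv 0 v q) (evalDeriv 1 w q) w :=
      hasDerivAt_evalDeriv 0 q w
    have h3 : (fun v => evalDeriv 0 v q) =
        fun v => g * evalDeriv 0 v (a • V) - evalDeriv 0 v (a • V) ^ 3 / 6 := by
      funext v
      simp only [hq, map_smul, map_sub, smul_eq_mul, evalDeriv_cube]
      ring
    rw [h3] at h2
    rw [h1.deriv, h2.unique ((h1.const_mul g).sub ((h1.pow 3).div_const 6))]
    push_cast
    ring
  rw [hflux]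
  refine (hasDerivAt_evalDeriv 1 q z).congr_deriv ?_
  rw [hq, map_smul, evalDeriv_two_of_fixedPoint hW, map_smul, smul_neg]

/-- The first-order invariant of the wave equation is constant along solutions. -/
lemma invariant_eq {g : ℝ} {U : ℝ → ℝ} (hU : Differentiable ℝ U)
    (h : ∀ z, HasDerivAt (fun w => (g - (1 / 2) * U w ^ 2) * deriv U w) (-U z) z) (z : ℝ) :
    (1/2) * (g - (1/2) * (U z) ^ 2) ^ 2 * (deriv U z) ^ 2 + (g / 2) * (U z) ^ 2
        - (1/8) * (U z) ^ 4 =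
      (1/2) * (g - (1/2) * (U 0) ^ 2) ^ 2 * (deriv U 0) ^ 2 + (g / 2) * (U 0) ^ 2
        - (1/8) * (U 0) ^ 4 := by
  have hd : ∀ w, HasDerivAt (fun v => (1/2) * ((g - (1 / 2) * U v ^ 2) * deriv U v) ^ 2
      + (g / 2) * (U v) ^ 2 - (1/8) * (U v) ^ 4) 0 w := fun w => by
    have h1 := (hU w).hasDerivAt
    refine ((((h w).pow 2).const_mul (1 / 2)).add ((h1.pow 2).const_mul (g / 2))).sub
      ((h1.pow 4).const_mul (1 / 8)) |>.congr_deriv ?_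
    push_cast
    ring
  have := is_const_of_deriv_eq_zero (fun w => (hd w).differentiableAt) (fun w => (hd w).deriv) z 0
  simp only [mul_pow] at this
  linear_combination this

lemma deriv_evalDeriv_zero (x : Coeff) : deriv (fun v => evalDeriv 0 v x) 0 = 0 := by
  have h : evalDeriv 1 0 = 0 := clm_ext fun k => by simp [evalDeriv_unit]
  rw [(hasDerivAt_evalDeriv 0 x 0).deriv, h, zero_apply]

lemma abs_invariant_sub_le {ε g w C : ℝ} (hε0 : 0 ≤ ε) (hε1 : ε ≤ 1) (hC : 0 ≤ C)
    (hg : |g - 1| ≤ C * ε) (hw : |w| ≤ C * ε) :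
    |(g / 2) * (ε * (1 + w) ^ 2) - (1 / 8) * (ε ^ 2 * (1 + w) ^ 4) - ε / 2| ≤
      (C + 1) ^ 4 * 2 * ε ^ 2 := by
  have hCε : C * ε ≤ C := by nlinarith
  have hw1 : |1 + w| ≤ C + 1 := by
    rw [abs_le] at hw ⊢
    constructor <;> linarith
  have e : (g / 2) * (ε * (1 + w) ^ 2) - (1 / 8) * (ε ^ 2 * (1 + w) ^ 4) - ε / 2 =
      ε * ((g - 1) / 2 * (1 + w) ^ 2) + ε * (w * ((1 + w) + 1) / 2)
        - (1 / 8) * (ε ^ 2 * (1 + w) ^ 4) := by ring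
  have t1 : |ε * ((g - 1) / 2 * (1 + w) ^ 2)| ≤ ε * (C * ε / 2 * (C + 1) ^ 2) := by
    rw [abs_mul, abs_mul, abs_div, abs_pow, abs_two, abs_of_nonneg hε0]
    gcongr
  have t2 : |ε * (w * ((1 + w) + 1) / 2)| ≤ ε * (C * ε * ((C + 1) + 1) / 2) := by
    rw [abs_mul, abs_div, abs_mul, abs_two, abs_of_nonneg hε0]
    gcongr
    exact (abs_add_le _ _).trans (by rw [abs_one]; linarith)
  have t3 : |(1 / 8) * (ε ^ 2 * (1 + w) ^ 4)| ≤ (1 / 8) * (ε ^ 2 * (C + 1) ^ 4) := by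
    rw [abs_mul, abs_mul, abs_pow (1 + w), abs_of_nonneg (sq_nonneg ε), abs_of_pos (by norm_num)]
    gcongr
  rw [e]
  refine (abs_sub _ _).trans ((add_le_add (abs_add_le _ _) le_rfl).trans ?_)
  refine (add_le_add (add_le_add t1 t2) t3).trans ?_
  have : 0 ≤ ε ^ 2 * ((C + 1) ^ 4 * 2 - (C / 2 * (C + 1) ^ 2 + C * (C + 2) / 2
      + (1 / 8) * (C + 1) ^ 4)) := by
    apply mul_nonneg (sq_nonneg _)
    ring_nf
    positivity
  linarith

end Wave

end StokesExpansion

end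

open StokesExpansion

theorem stokes_expansion_modified_reduced_ostrovsky :
    ∃ a₀ > (0:ℝ), ∃ γ : ℝ → ℝ, ∃ U : ℝ → ℝ → ℝ, ∃ I : ℝ → ℝ,
      (∀ a : ℝ, |a| < a₀ →
        ContDiff ℝ (⊤ : ℕ∞) (U a) ∧ (∀ z : ℝ, U a (-z) = U a z) ∧
        Function.Periodic (U a) (2 * π) ∧
        (∀ z : ℝ,
          deriv (fun w => (γ a - (1/2) * (U a w) ^ 2) * deriv (U a) w) z + U a z = 0)) ∧
      (∀ n : ℕ, ∃ C > (0:ℝ), ∀ a : ℝ, |a| < a₀ → ∀ z : ℝ,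
        |iteratedDeriv n
          (fun w => U a w - a * Real.cos w - (3 * a ^ 3 / 64) * Real.cos (3 * w)) z|
          ≤ C * |a| ^ 5) ∧
      (∃ C > (0:ℝ), ∀ a : ℝ, |a| < a₀ → |γ a - 1 - a ^ 2 / 8| ≤ C * a ^ 4) ∧
      (∃ C > (0:ℝ), ∀ a : ℝ, |a| < a₀ →
        (∀ z : ℝ,
          (1/2) * (γ a - (1/2) * (U a z) ^ 2) ^ 2 * (deriv (U a) z) ^ 2
            + (γ a / 2) * (U a z) ^ 2 - (1/8) * (U a z) ^ 4 = I a) ∧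
        |I a - a ^ 2 / 2| ≤ C * a ^ 4) := by
  obtain ⟨ε₀, hε₀, C, hC, hsol⟩ := exists_small_fixedPoint contDiff_profileMap.contDiffAt
    contDiff_speed.contDiffAt
  have hsol' : ∀ ε : ℝ, ∃ W : Coeff, |ε| < ε₀ → W = ε • profileMap W ∧
      ‖W‖ ≤ C * |ε| ∧ ‖W - ε • profileMap 0‖ ≤ C * ε ^ 2 ∧ |speed W - speed 0| ≤ C * |ε| := by
    intro ε
    by_cases h : |ε| < ε₀
    · obtain ⟨W, hW⟩ := hsol ε h
      exact ⟨W, fun _ => hW⟩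
    · exact ⟨0, fun h' => absurd h' h⟩
  choose W hW using hsol'
  have hsq : ∀ a : ℝ, |a| < min 1 ε₀ → a ^ 2 ≤ 1 ∧ |a ^ 2| < ε₀ := fun a ha => by
    have h1 := ha.trans_le (min_le_left _ _)
    have h2 := ha.trans_le (min_le_right _ _)
    rw [abs_pow, ← sq_abs a]
    constructor <;> nlinarith [abs_nonneg a]
  let γ : ℝ → ℝ := fun a => 1 + a ^ 2 * speed (W (a ^ 2))
  let U : ℝ → ℝ → ℝ := fun a z => evalDeriv 0 z (a • (cosCoeff + W (a ^ 2)))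
  have hγ : ∀ a : ℝ, |a| < min 1 ε₀ → |γ a - 1 - a ^ 2 / 8| ≤ C * a ^ 4 := fun a ha => by
    obtain ⟨-, -, -, h⟩ := hW _ (hsq a ha).2
    rw [speed_zero, abs_of_nonneg (sq_nonneg a)] at h
    calc |γ a - 1 - a ^ 2 / 8| = |a ^ 2 * (speed (W (a ^ 2)) - 1 / 8)| := by
          congr 1; simp only [γ]; ring
      _ = a ^ 2 * |speed (W (a ^ 2)) - 1 / 8| := by
          rw [abs_mul, abs_of_nonneg (sq_nonneg a)]
      _ ≤ a ^ 2 * (C * a ^ 2) := by gcongr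
      _ = C * a ^ 4 := by ring
  refine ⟨min 1 ε₀, by positivity, γ, U, fun a => (γ a / 2) * (U a 0) ^ 2 - (1/8) * (U a 0) ^ 4,
    fun a ha => ⟨contDiff_evalDeriv _, fun z => ?_, fun z => ?_, fun z => ?_⟩,
    fun n => ⟨n.factorial * C, by positivity, fun a ha z => ?_⟩, ⟨C, hC, hγ⟩,
    ⟨(C + 1 + 1) ^ 4 * 2, by positivity, fun a ha => ⟨fun z => ?_, ?_⟩⟩⟩
  · simp only [U, evalDeriv_neg]
  · simp only [U, evalDeriv_add_two_pi]
  · rw [(hasDerivAt_flux (hW _ (hsq a ha).2).1 z).deriv]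
    exact neg_add_cancel _
  · obtain ⟨-, -, h, -⟩ := hW _ (hsq a ha).2
    have e : (fun w => U a w - a * cos w - (3 * a ^ 3 / 64) * cos (3 * w)) =
        fun w => evalDeriv 0 w (a • (W (a ^ 2) - a ^ 2 • profileMap 0)) := by
      funext w
      simp only [U, map_smul, map_add, map_sub, smul_eq_mul, evalDeriv_cosCoeff,
        evalDeriv_profileMap_zero]
      ring
    rw [e, iteratedDeriv_evalDeriv]
    calc |evalDeriv n z (a • (W (a ^ 2) - a ^ 2 • profileMap 0))|
        ≤ n.factorial * ‖a • (W (a ^ 2) - a ^ 2 • profileMap 0)‖ := abs_evalDeriv_le _ _ _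
      _ ≤ n.factorial * (|a| * (C * (a ^ 2) ^ 2)) := by
          rw [norm_smul, Real.norm_eq_abs]
          gcongr
      _ = n.factorial * C * |a| ^ 5 := by rw [← sq_abs a]; ring
  · rw [invariant_eq ((contDiff_evalDeriv _).differentiable (by simp))
      (fun z => hasDerivAt_flux (hW _ (hsq a ha).2).1 z) z]
    simp only [U, deriv_evalDeriv_zero]
    ring
  · obtain ⟨-, h, -, -⟩ := hW _ (hsq a ha).2
    rw [abs_of_nonneg (sq_nonneg a)] at h
    have hw : |evalDeriv 0 0 (W (a ^ 2))| ≤ (C + 1) * a ^ 2 := by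
      have := abs_evalDeriv_le 0 0 (W (a ^ 2))
      rw [Nat.factorial_zero, Nat.cast_one, one_mul] at this
      nlinarith [sq_nonneg a]
    have hg : |γ a - 1| ≤ (C + 1) * a ^ 2 := by
      have h1 := abs_add_le (γ a - 1 - a ^ 2 / 8) (a ^ 2 / 8)
      rw [sub_add_cancel, abs_of_nonneg (by positivity : 0 ≤ a ^ 2 / 8)] at h1
      have h2 : C * a ^ 4 ≤ C * a ^ 2 := by
        gcongr ?_ * ?_
        nlinarith [sq_nonneg a, (hsq a ha).1]
      nlinarith [hγ a ha, sq_nonneg a]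
    have hfin := abs_invariant_sub_le (sq_nonneg a) (hsq a ha).1 (by positivity) hg hw
    have hU : U a 0 = a * (1 + evalDeriv 0 0 (W (a ^ 2))) := by
      simp only [U, map_smul, map_add, smul_eq_mul, evalDeriv_cosCoeff, cos_zero]
    simp only [hU]
    convert hfin using 2 <;> ring
end

section
/- Let γ ∈ ℝ and let U : ℝ → ℝ be a C² solution of ((γ − (1/2)·U(z)²)·U'(z))' + U(z) = 0 on ℝ. Then the function I(z) = (1/2)(γ − (1/2)U(z)²)²·U'(z)² + (γ/2)·U(z)² − (1/8)·U(z)⁴ is constant on ℝ; denoting its constant value by I, one has the pointwise identity (γ − (1/2)·U(z)²)²·(1 − U'(z)²) = γ² − 2I for every z ∈ ℝ. -/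
theorem first_order_invariant_modified_reduced_ostrovsky
    (γ : ℝ) (U : ℝ → ℝ) (hU : ContDiff ℝ 2 U)
    (hODE : ∀ z : ℝ,
      deriv (fun w => (γ - (1/2) * (U w) ^ 2) * deriv U w) z + U z = 0) :
    ∃ I : ℝ,
      (∀ z : ℝ,
        (1/2) * (γ - (1/2) * (U z) ^ 2) ^ 2 * (deriv U z) ^ 2
          + (γ / 2) * (U z) ^ 2 - (1/8) * (U z) ^ 4 = I) ∧
      (∀ z : ℝ,
        (γ - (1/2) * (U z) ^ 2) ^ 2 * (1 - (deriv U z) ^ 2) = γ ^ 2 - 2 * I) := by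
  have hdU : Differentiable ℝ U := hU.differentiable (by norm_num)
  have hddU : Differentiable ℝ (deriv U) := hU.differentiable_deriv_two
  have hflux (z : ℝ) :
      HasDerivAt (fun w => (γ - (1/2) * (U w) ^ 2) * deriv U w) (-U z) z := by
    have hdiff : Differentiable ℝ (fun w => (γ - (1/2) * (U w) ^ 2) * deriv U w) := by
      fun_prop
    rw [← eq_neg_of_add_eq_zero_left (hODE z)]
    exact (hdiff z).hasDerivAt
  let J : ℝ → ℝ := fun z =>
    (1/2) * ((γ - (1/2) * (U z) ^ 2) * deriv U z) ^ 2
      + (γ / 2) * (U z) ^ 2 - (1/8) * (U z) ^ 4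
  have hJ (z : ℝ) : HasDerivAt J 0 z := by
    have hUz := (hdU z).hasDerivAt
    refine (((((hflux z).pow 2).const_mul (1/2)).add ((hUz.pow 2).const_mul (γ / 2))).sub
      ((hUz.pow 4).const_mul (1/8))).congr_deriv ?_
    push_cast
    ring
  have hconst (z : ℝ) : J z = J 0 :=
    is_const_of_deriv_eq_zero (fun z => (hJ z).differentiableAt) (fun z => (hJ z).deriv) z 0
  refine ⟨J 0, fun z => ?_, fun z => ?_⟩ <;>
  · rw [← hconst z]
    simp only [J]
    ring
end

section
/- Let γ > 0, Γ ∈ ℝ, and let U : ℝ → ℝ be a smooth, nonconstant, 2π-periodic solution of ((γ − (1/2)·U(z)²)·U'(z))' + U(z) = 0 with |U'(z)| < 1 and U(z)² < 2γ for all z ∈ ℝ, and let I denote the constant value of the first-order invariant (then automatically γ² − 2I > 0). Then U''(z) = 2Γ·U(z)·(1 − U'(z)²)^{3/2} for all z ∈ ℝ if and only if Γ = −1/(2·(γ² − 2I)^{1/2}). -/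
open Real

/-- The invariant determines `√(γ² - 2I)` as a product of the positive coefficient
`γ - u² / 2` and the arc-type factor `√(1 - p²)`. -/
lemma sqrt_sq_sub_two_mul_invariant {γ u p I : ℝ} (ha : 0 < γ - (1/2) * u ^ 2)
    (hI : (1/2) * (γ - (1/2) * u ^ 2) ^ 2 * p ^ 2 + (γ / 2) * u ^ 2 - (1/8) * u ^ 4 = I) :
    √(γ ^ 2 - 2 * I) = (γ - (1/2) * u ^ 2) * √(1 - p ^ 2) := by
  have h : γ ^ 2 - 2 * I = (γ - (1/2) * u ^ 2) ^ 2 * (1 - p ^ 2) := by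
    rw [← hI]; ring
  rw [h, Real.sqrt_mul (sq_nonneg _), Real.sqrt_sq ha.le]

lemma rpow_three_halves_eq_sqrt_pow {x : ℝ} (hx : 0 ≤ x) : x ^ ((3:ℝ)/2) = √x ^ 3 := by
  rw [Real.sqrt_eq_rpow, ← Real.rpow_natCast, ← Real.rpow_mul hx]
  norm_num

/-- The modified reduced Ostrovsky wave equation with the derivative of the flux expanded. -/
lemma ostrovsky_expand {γ : ℝ} {U : ℝ → ℝ} (hU : ContDiff ℝ 2 U) {z : ℝ}
    (hODE : deriv (fun w => (γ - (1/2) * (U w) ^ 2) * deriv U w) z + U z = 0) :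
    (γ - (1/2) * (U z) ^ 2) * iteratedDeriv 2 U z = -(U z * (1 - (deriv U z) ^ 2)) := by
  have h1 : HasDerivAt U (deriv U z) z :=
    (hU.differentiable (by norm_num) z).hasDerivAt
  have h2 : HasDerivAt (deriv U) (iteratedDeriv 2 U z) z := by
    have h := (hU.differentiable_iteratedDeriv 1 (by norm_num) z).hasDerivAt
    rwa [← iteratedDeriv_succ, iteratedDeriv_one] at h
  have h3 := (((h1.pow 2).const_mul (1/2 : ℝ)).const_sub γ).mul h2
  have h4 : deriv (fun w => (γ - (1/2) * (U w) ^ 2) * deriv U w) z = _ := h3.deriv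
  rw [h4] at hODE
  simp at hODE
  linear_combination hODE

theorem euler_lagrange_casimir_modified_reduced_ostrovsky
    (γ Γ : ℝ) (hγ : 0 < γ) (U : ℝ → ℝ) (hU : ContDiff ℝ (⊤ : ℕ∞) U)
    (hnc : ∃ z w : ℝ, U z ≠ U w)
    (hper : Function.Periodic U (2 * π))
    (hODE : ∀ z : ℝ,
      deriv (fun w => (γ - (1/2) * (U w) ^ 2) * deriv U w) z + U z = 0)
    (hslope : ∀ z : ℝ, |deriv U z| < 1)
    (hamp : ∀ z : ℝ, (U z) ^ 2 < 2 * γ)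
    (I : ℝ)
    (hI : ∀ z : ℝ,
      (1/2) * (γ - (1/2) * (U z) ^ 2) ^ 2 * (deriv U z) ^ 2
        + (γ / 2) * (U z) ^ 2 - (1/8) * (U z) ^ 4 = I) :
    (∀ z : ℝ,
        iteratedDeriv 2 U z
          = 2 * Γ * U z * (1 - (deriv U z) ^ 2) ^ ((3:ℝ)/2))
    ↔ Γ = -1 / (2 * Real.sqrt (γ ^ 2 - 2 * I)) := by
  have ha (z : ℝ) : 0 < γ - (1/2) * (U z) ^ 2 := by linarith [hamp z]
  have hq (z : ℝ) : 0 < 1 - (deriv U z) ^ 2 := by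
    linarith [(sq_lt_one_iff_abs_lt_one _).2 (hslope z)]
  have hs : 0 < √(γ ^ 2 - 2 * I) := by
    rw [sqrt_sq_sub_two_mul_invariant (ha 0) (hI 0)]
    exact mul_pos (ha 0) (Real.sqrt_pos.2 (hq 0))
  have hU2 : ContDiff ℝ 2 U := mod_cast contDiff_infty.1 hU 2
  have key (z : ℝ) : iteratedDeriv 2 U z
      = 2 * (-1 / (2 * √(γ ^ 2 - 2 * I))) * U z * (1 - (deriv U z) ^ 2) ^ ((3:ℝ)/2) := by
    have hr : 0 < √(1 - (deriv U z) ^ 2) := Real.sqrt_pos.2 (hq z)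
    have hode := ostrovsky_expand hU2 (hODE z)
    rw [rpow_three_halves_eq_sqrt_pow (hq z).le, sqrt_sq_sub_two_mul_invariant (ha z) (hI z)]
    rw [← Real.sq_sqrt (hq z).le] at hode
    have ha' := (ha z).ne'
    generalize √(1 - (deriv U z) ^ 2) = r at *
    generalize γ - (1/2) * (U z) ^ 2 = a at *
    field_simp
    linear_combination hode
  constructor
  · intro h
    obtain ⟨z, hz⟩ : ∃ z, U z ≠ 0 := by
      by_contra! h0
      obtain ⟨z, w, hzw⟩ := hnc
      exact hzw (by rw [h0, h0])
    have h1 := (h z).symm.trans (key z)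
    have h2 := mul_right_cancel₀ hz (mul_right_cancel₀ (Real.rpow_pos_of_pos (hq z) _).ne' h1)
    exact mul_left_cancel₀ two_ne_zero h2
  · rintro rfl
    exact key
end

section
/- Let c ∈ ℝ. The following are equivalent: (i) c = 2; (ii) for every integer N ≥ 1 and every smooth 2πN-periodic function v : ℝ → ℝ with ∫₀^{2πN} v = 0, letting w denote the zero-mean primitive of v, one has ∫₀^{2πN} [ w(z)² − (1 + c/2)·v(z)² + (c/2)·v'(z)² ] dz ≥ 0. -/
open Real

/-- The zero-mean primitive of a zero-mean `L`-periodic function: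
the primitive `z ↦ ∫₀^z v`, shifted so that its mean over `[0, L]` is zero. -/
noncomputable def zeroMeanPrimitive (L : ℝ) (v : ℝ → ℝ) : ℝ → ℝ :=
  fun z => (∫ t in (0:ℝ)..z, v t) - (1 / L) * ∫ t in (0:ℝ)..L, (∫ s in (0:ℝ)..t, v s)

lemma hasDerivAt_zeroMeanPrimitive {L : ℝ} {v : ℝ → ℝ} (hv : Continuous v) (z : ℝ) :
    HasDerivAt (zeroMeanPrimitive L v) (v z) z :=
  (intervalIntegral.integral_hasDerivAt_right (hv.intervalIntegrable _ _)
    (hv.stronglyMeasurableAtFilter _ _) hv.continuousAt).sub_const _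

lemma zeroMeanPrimitive_right_eq_left {L : ℝ} {v : ℝ → ℝ} (h : ∫ z in (0:ℝ)..L, v z = 0) :
    zeroMeanPrimitive L v L = zeroMeanPrimitive L v 0 := by
  simp [zeroMeanPrimitive, h]

/-- Integration by parts for a periodic function against its zero-mean primitive. -/
lemma integral_zeroMeanPrimitive_mul_deriv {L : ℝ} {v : ℝ → ℝ} (hv : ContDiff ℝ 1 v)
    (hper : Function.Periodic v L) (h : ∫ z in (0:ℝ)..L, v z = 0) :
    ∫ z in (0:ℝ)..L, zeroMeanPrimitive L v z * deriv v z = -∫ z in (0:ℝ)..L, v z ^ 2 := by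
  have hd : Continuous (deriv v) := hv.continuous_deriv le_rfl
  rw [intervalIntegral.integral_mul_deriv_eq_deriv_mul (u := zeroMeanPrimitive L v) (v := v)
    (u' := v) (v' := deriv v) (fun z _ => hasDerivAt_zeroMeanPrimitive hv.continuous z)
    (fun z _ => (hv.differentiable one_ne_zero z).hasDerivAt)
    (hv.continuous.intervalIntegrable _ _) (hd.intervalIntegrable _ _),
    zeroMeanPrimitive_right_eq_left h, hper.eq]
  simp [sq]

/-- At `c = 2` the second variation is the integral of a perfect square. -/
lemma integral_second_variation_two_eq {L : ℝ} {v : ℝ → ℝ} (hv : ContDiff ℝ 1 v)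
    (hper : Function.Periodic v L) (h : ∫ z in (0:ℝ)..L, v z = 0) :
    ∫ z in (0:ℝ)..L, (zeroMeanPrimitive L v z ^ 2 - 2 * v z ^ 2 + deriv v z ^ 2) =
      ∫ z in (0:ℝ)..L, (zeroMeanPrimitive L v z + deriv v z) ^ 2 := by
  have hd : Continuous (deriv v) := hv.continuous_deriv le_rfl
  have hc : Continuous v := hv.continuous
  have hw : Continuous (zeroMeanPrimitive L v) :=
    continuous_iff_continuousAt.2 fun z => (hasDerivAt_zeroMeanPrimitive hc z).continuousAt
  have hsplit : ∀ z, (zeroMeanPrimitive L v z + deriv v z) ^ 2 =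
      (zeroMeanPrimitive L v z ^ 2 - 2 * v z ^ 2 + deriv v z ^ 2) +
        (2 * (zeroMeanPrimitive L v z * deriv v z) + 2 * v z ^ 2) := fun z => by ring
  have hcross : ∫ z in (0:ℝ)..L,
      (2 * (zeroMeanPrimitive L v z * deriv v z) + 2 * v z ^ 2) = 0 := by
    rw [intervalIntegral.integral_add (Continuous.intervalIntegrable (by fun_prop) _ _)
        (Continuous.intervalIntegrable (by fun_prop) _ _),
      intervalIntegral.integral_const_mul, intervalIntegral.integral_const_mul,
      integral_zeroMeanPrimitive_mul_deriv hv hper h]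
    ring
  rw [intervalIntegral.integral_congr fun z _ => hsplit z, intervalIntegral.integral_add
    (μ := MeasureTheory.volume)
    (f := fun z => zeroMeanPrimitive L v z ^ 2 - 2 * v z ^ 2 + deriv v z ^ 2)
    (Continuous.intervalIntegrable (by fun_prop) _ _)
    (Continuous.intervalIntegrable (by fun_prop) _ _), hcross, add_zero]

lemma integral_cos_const_mul {k : ℝ} (hk : k ≠ 0) (z : ℝ) :
    ∫ t in (0:ℝ)..z, cos (k * t) = sin (k * z) / k := by
  rw [intervalIntegral.integral_comp_mul_left (fun t => cos t) hk]
  simp [div_eq_inv_mul]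

lemma zeroMeanPrimitive_cos {k L : ℝ} {n : ℕ} (hk : k ≠ 0) (hkL : k * L = n * (2 * π)) (z : ℝ) :
    zeroMeanPrimitive L (fun z => cos (k * z)) z = sin (k * z) / k := by
  simp only [zeroMeanPrimitive, integral_cos_const_mul hk, intervalIntegral.integral_div]
  rw [intervalIntegral.integral_comp_mul_left (fun t => sin t) hk, hkL]
  simp

/-- The second variation on the single mode `cos (k z)`, where `k L` is a multiple of `2π`. -/
lemma integral_second_variation_cos {k L : ℝ} {n : ℕ} (hk : k ≠ 0) (hkL : k * L = n * (2 * π))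
    (c : ℝ) :
    ∫ z in (0:ℝ)..L, (zeroMeanPrimitive L (fun z => cos (k * z)) z ^ 2
      - (1 + c / 2) * cos (k * z) ^ 2 + (c / 2) * deriv (fun z => cos (k * z)) z ^ 2) =
      L / 2 * ((1 - k ^ 2) * (1 / k ^ 2 - c / 2)) := by
  have hderiv : ∀ z, deriv (fun z => cos (k * z)) z = -sin (k * z) * k := fun z => by
    simpa using (((hasDerivAt_id z).const_mul k).cos).deriv
  have hsin : sin (n * (2 * π)) = 0 := by
    simpa using Real.sin_add_nat_mul_two_pi 0 n
  have hform : ∀ z, (sin (k * z) / k) ^ 2 - (1 + c / 2) * cos (k * z) ^ 2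
      + (c / 2) * (-sin (k * z) * k) ^ 2 =
      (1 / k ^ 2 + 1 + c / 2 + c / 2 * k ^ 2) * sin (k * z) ^ 2 - (1 + c / 2) := fun z => by
    rw [cos_sq']; ring
  simp_rw [zeroMeanPrimitive_cos hk hkL, hderiv, hform]
  rw [intervalIntegral.integral_sub (Continuous.intervalIntegrable (by fun_prop) _ _)
      (Continuous.intervalIntegrable (by fun_prop) _ _), intervalIntegral.integral_const_mul,
    intervalIntegral.integral_comp_mul_left (fun t => sin t ^ 2) hk, integral_sin_sq, hkL, hsin,
    ← hkL]
  simp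
  field_simp
  ring

theorem positivity_second_variation_zero_modified_reduced_ostrovsky (c : ℝ) :
    c = 2 ↔
    ∀ N : ℕ, 1 ≤ N → ∀ v : ℝ → ℝ, ContDiff ℝ (⊤ : ℕ∞) v →
      Function.Periodic v (2 * π * N) →
      (∫ z in (0:ℝ)..(2 * π * N), v z) = 0 →
      0 ≤ ∫ z in (0:ℝ)..(2 * π * N),
        ((zeroMeanPrimitive (2 * π * N) v z) ^ 2
          - (1 + c/2) * (v z) ^ 2 + (c/2) * (deriv v z) ^ 2) := by
  constructor
  · rintro rfl N - v hv hper h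
    have hL : (0:ℝ) ≤ 2 * π * N := by positivity
    have key := integral_second_variation_two_eq (hv.of_le (by exact_mod_cast le_top)) hper h
    norm_num at key ⊢
    rw [key]
    exact intervalIntegral.integral_nonneg hL fun z _ => sq_nonneg _
  · intro H
    have symbol_nonneg : ∀ n N : ℕ, 0 < n → 0 < N →
        0 ≤ (1 - ((n:ℝ) / N) ^ 2) * (1 / ((n:ℝ) / N) ^ 2 - c / 2) := by
      intro n N hn hN
      have hn' : (0:ℝ) < n := by exact_mod_cast hn
      have hN' : (0:ℝ) < N := by exact_mod_cast hN
      have hk : (n:ℝ) / N ≠ 0 := by positivity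
      have hkL : (n:ℝ) / N * (2 * π * N) = n * (2 * π) := by field_simp
      have hnonneg := H N hN (fun z => cos (n / N * z)) (by fun_prop)
        (fun z => by simp only [mul_add, hkL, cos_add_nat_mul_two_pi])
        (by
          rw [integral_cos_const_mul hk, hkL, ← zero_add (n * (2 * π)),
            sin_add_nat_mul_two_pi, sin_zero, zero_div])
      rw [integral_second_variation_cos hk hkL] at hnonneg
      exact nonneg_of_mul_nonneg_right hnonneg (by positivity)
    have hlim : Filter.Tendsto (fun m : ℕ => ((m:ℝ) / (m + 1)) ^ 2) Filter.atTop (nhds 1) := by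
      simpa using (tendsto_natCast_div_add_atTop (1:ℝ)).pow 2
    have lower : 1 ≤ c / 2 := by
      refine le_of_tendsto hlim ((Filter.eventually_gt_atTop 0).mono fun m hm => ?_)
      have hm' : (0:ℝ) < m := by exact_mod_cast hm
      have hs := symbol_nonneg (m + 1) m m.succ_pos hm
      push_cast at hs
      have hgt : 1 < (((m:ℝ) + 1) / m) ^ 2 :=
        one_lt_pow₀ ((one_lt_div hm').2 (by linarith)) two_ne_zero
      have hle := nonpos_of_mul_nonneg_right hs (by linarith)
      rw [one_div, ← inv_pow, inv_div] at hle
      linarith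
    have upper : c / 2 * 1 ≤ 1 := by
      refine le_of_tendsto (hlim.const_mul (c / 2))
        ((Filter.eventually_gt_atTop 0).mono fun m hm => ?_)
      have hm' : (0:ℝ) < m := by exact_mod_cast hm
      have hs := symbol_nonneg m (m + 1) hm m.succ_pos
      push_cast at hs
      have hlt : ((m:ℝ) / (m + 1)) ^ 2 < 1 :=
        pow_lt_one₀ (by positivity) ((div_lt_one (by positivity)).2 (by linarith)) two_ne_zero
      have hle := nonneg_of_mul_nonneg_right hs (by linarith)
      rw [← le_div_iff₀ (by positivity)]
      linarith
    linarith
end
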